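/- For every n ≥ 0, substituting q = 1 and u = 1 in the type B generating polynomial Z^B_n(α,β,γ,δ;q,u,z) yields the polynomial (z·(α+β)+γ+δ)^n · ∏_{i=1}^{n−1} (1 + i·(β+δ)). -/

import Mathlib

open MvPolynomial Finset

noncomputable section

/-- The polynomial ring `ℚ[α,β,γ,δ,q,u]`: variables `0,1,2,3,4,5` are `α,β,γ,δ,q,u`. -/
abbrev P6 : Type := MvPolynomial (Fin 6) ℚ

/-- A staircase tableau of size `n` is an assignment, to each cell `(i,j)` with `j ≤ i`
(indices `0`-based here, rows numbered bottom to top, columns left to right), of either the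
empty label (`none`) or one of the four symbols `α,β,γ,δ` (`some 0, some 1, some 2, some 3`),
such that every diagonal cell is non-empty, the cells above an `α/γ` in its column are empty,
and the cells to the left of a `β/δ` in its row are empty.  Cells outside the staircase
(`i < j`) carry `none`. -/
def IsStaircase (n : ℕ) (T : Fin n → Fin n → Option (Fin 4)) : Prop :=
  (∀ i j : Fin n, i < j → T i j = none) ∧
  (∀ i : Fin n, T i i ≠ none) ∧
  (∀ i j i' : Fin n, j ≤ i → i < i' → (T i j = some 0 ∨ T i j = some 2) → T i' j = none) ∧
  (∀ i j j' : Fin n, j' < j → j ≤ i → (T i j = some 1 ∨ T i j = some 3) → T i j' = none)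

instance IsStaircase.decPred (n : ℕ) : DecidablePred (IsStaircase n) := fun _ =>
  @instDecidableAnd _ _ inferInstance
    (@instDecidableAnd _ _ inferInstance (@instDecidableAnd _ _ inferInstance inferInstance))

/-- The type of staircase tableaux of size `n`. -/
def StaircaseTableau (n : ℕ) : Type := {T : Fin n → Fin n → Option (Fin 4) // IsStaircase n T}

instance (n : ℕ) : Fintype (StaircaseTableau n) := Subtype.fintype _

/-- The label of the nearest non-empty cell to the right of the cell `(i,j)` in its row
(`none` if there is no such cell). -/
def nearestRight (n : ℕ) (T : Fin n → Fin n → Option (Fin 4)) (i j : Fin n) :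
    Option (Fin 4) :=
  if h : (univ.filter fun j' : Fin n => j < j' ∧ T i j' ≠ none).Nonempty then
    T i ((univ.filter fun j' : Fin n => j < j' ∧ T i j' ≠ none).min' h)
  else none

/-- The label of the nearest non-empty cell below the cell `(i,j)` in its column
(`none` if there is no such cell). -/
def nearestBelow (n : ℕ) (T : Fin n → Fin n → Option (Fin 4)) (i j : Fin n) :
    Option (Fin 4) :=
  if h : (univ.filter fun i' : Fin n => i' < i ∧ T i' j ≠ none).Nonempty then
    T ((univ.filter fun i' : Fin n => i' < i ∧ T i' j ≠ none).max' h) j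
  else none

/-- The condition for an empty cell to receive a `q` in the `q/u` filling: the nearest
non-empty cell to its right contains a `δ`, or the nearest non-empty cell to its right
contains an `α` or a `γ` and the nearest non-empty cell below it contains a `β` or a `γ`. -/
def QCell (n : ℕ) (T : Fin n → Fin n → Option (Fin 4)) (i j : Fin n) : Prop :=
  nearestRight n T i j = some 3 ∨
    ((nearestRight n T i j = some 0 ∨ nearestRight n T i j = some 2) ∧
      (nearestBelow n T i j = some 1 ∨ nearestBelow n T i j = some 2))

instance (n : ℕ) (T : Fin n → Fin n → Option (Fin 4)) (i j : Fin n) :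
    Decidable (QCell n T i j) := by
  unfold QCell; infer_instance

/-- A staircase tableau of size `2n` is fixed by the involution `ψ` when the entry of each
cell `(i,j)` equals the entry of the cell `(2n+1−j, 2n+1−i)` (in the `1`-based numbering,
i.e. `(Fin.rev j, Fin.rev i)` here) with `α ↔ δ` and `β ↔ γ` exchanged (the exchange of
symbols is `Fin.rev` on `Fin 4`). -/
def IsTypeB (n : ℕ) (T : Fin (2 * n) → Fin (2 * n) → Option (Fin 4)) : Prop :=
  ∀ i j : Fin (2 * n), T i j = Option.map Fin.rev (T j.rev i.rev)

instance (n : ℕ) (T : Fin (2 * n) → Fin (2 * n) → Option (Fin 4)) :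
    Decidable (IsTypeB n T) := by
  unfold IsTypeB; infer_instance

/-- The type of type `B` staircase tableaux of size `n`: staircase tableaux of size `2n`
fixed by the involution `ψ`. -/
def TypeBTableau (n : ℕ) : Type := {T : StaircaseTableau (2 * n) // IsTypeB n T.1}

instance (n : ℕ) : Fintype (TypeBTableau n) := Subtype.fintype _

/-- The polynomial ring `ℚ[α,β,γ,δ,q,u,z]`: variables `0,…,6` are `α,β,γ,δ,q,u,z`. -/
abbrev P7 : Type := MvPolynomial (Fin 7) ℚ

/-- The entry of the cell `(i,j)` after the `q/u` filling, as a monomial of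
`ℚ[α,β,γ,δ,q,u,z]`. -/
def cellValue7 (n : ℕ) (T : Fin n → Fin n → Option (Fin 4)) (i j : Fin n) : P7 :=
  match T i j with
  | some s => X (Fin.castLE (by omega) s)
  | none => if QCell n T i j then X 4 else X 5

/-- The weight of a type `B` staircase tableau of size `n`: `z^d` times the product of the
entries, after the `q/u` filling of the full size-`2n` tableau, of the bottom-half cells
(`1`-based `i+j ≤ 2n+1`, i.e. `0`-based `i+j < 2n`), where `d` is the number of `q`'s among
the cells of the symmetry diagonal (`1`-based `i+j = 2n+1`, i.e. `0`-based `i+j+1 = 2n`). -/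
def wtB {n : ℕ} (T : TypeBTableau n) : P7 :=
  (X 6 : P7) ^
      (univ.filter fun p : Fin (2 * n) × Fin (2 * n) =>
          p.2 ≤ p.1 ∧ p.1.val + p.2.val + 1 = 2 * n ∧ T.1.1 p.1 p.2 = none ∧
            QCell (2 * n) T.1.1 p.1 p.2).card *
    ∏ i : Fin (2 * n), ∏ j : Fin (2 * n),
      if j ≤ i ∧ i.val + j.val < 2 * n then cellValue7 (2 * n) T.1.1 i j else 1

/-- The type `B` generating polynomial `Z^B_n(α,β,γ,δ;q,u,z)`. -/
def ZB (n : ℕ) : P7 := ∑ T : TypeBTableau n, wtB T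

/-- The substitution `q = 1`, `u = 1` in `ℚ[α,β,γ,δ,q,u,z]`. -/
def subQU7 : P7 →ₐ[ℚ] P7 := aeval (fun i : Fin 7 => if i.val = 4 ∨ i.val = 5 then 1 else X i)

/-- An index of `Fin M` seen as an interior index of `Fin (M + 2)`. -/
def midIdx {M : ℕ} (i : Fin M) : Fin (M + 2) := i.castSucc.succ

lemma forall_ends {M : ℕ} {P : Fin (M + 2) → Prop} :
    (∀ i, P i) ↔ P 0 ∧ (∀ i : Fin M, P (midIdx i)) ∧ P (Fin.last (M + 1)) := by
  rw [Fin.forall_fin_succ, Fin.forall_fin_succ']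
  simp [midIdx]

lemma exists_ends {M : ℕ} {P : Fin (M + 2) → Prop} :
    (∃ i, P i) ↔ P 0 ∨ (∃ i : Fin M, P (midIdx i)) ∨ P (Fin.last (M + 1)) := by
  rw [Fin.exists_fin_succ, Fin.exists_fin_succ']
  simp [midIdx]

lemma prod_ends {M : ℕ} {R : Type*} [CommMonoid R] (g : Fin (M + 2) → R) :
    ∏ i, g i = g 0 * ((∏ i : Fin M, g (midIdx i)) * g (Fin.last (M + 1))) := by
  rw [Fin.prod_univ_succ, Fin.prod_univ_castSucc]
  simp [midIdx]

@[simp] lemma midIdx_val {M : ℕ} (i : Fin M) : (midIdx i).val = i.val + 1 := rfl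

@[simp] lemma midIdx_rev {M : ℕ} (i : Fin M) : (midIdx i).rev = midIdx i.rev := by
  ext; simp [Fin.val_rev]; omega

@[simp] lemma midIdx_lt_midIdx {M : ℕ} (i j : Fin M) : midIdx i < midIdx j ↔ i < j := by
  rw [Fin.lt_def, Fin.lt_def]; simp

@[simp] lemma midIdx_le_midIdx {M : ℕ} (i j : Fin M) : midIdx i ≤ midIdx j ↔ i ≤ j := by
  rw [Fin.le_def, Fin.le_def]; simp

@[simp] lemma zero_lt_midIdx {M : ℕ} (i : Fin M) : 0 < midIdx i := by
  rw [Fin.lt_def]; simp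

@[simp] lemma midIdx_lt_last {M : ℕ} (i : Fin M) : midIdx i < Fin.last (M + 1) := by
  rw [Fin.lt_def]; simp

@[simp] lemma not_last_lt_midIdx {M : ℕ} (i : Fin M) : ¬ Fin.last (M + 1) < midIdx i :=
  not_lt.2 (midIdx_lt_last i).le

/-- The function on `Fin (M + 2)` with prescribed end values and interior values. -/
def withEnds {M : ℕ} {A : Type*} (a : A) (f : Fin M → A) (b : A) : Fin (M + 2) → A :=
  Fin.cons a (Fin.snoc f b : Fin (M + 1) → A)

@[simp] lemma withEnds_zero {M : ℕ} {A : Type*} (a : A) (f : Fin M → A) (b : A) :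
    withEnds a f b 0 = a := rfl

@[simp] lemma withEnds_midIdx {M : ℕ} {A : Type*} (a : A) (f : Fin M → A) (b : A) (i : Fin M) :
    withEnds a f b (midIdx i) = f i := by
  simp [withEnds, midIdx]

@[simp] lemma withEnds_last {M : ℕ} {A : Type*} (a : A) (f : Fin M → A) (b : A) :
    withEnds a f b (Fin.last (M + 1)) = b := by
  rw [← Fin.succ_last, withEnds, Fin.cons_succ, Fin.snoc_last]

/-- Invariance under the involution `ψ`, for a filling of arbitrary size. -/
def IsMirror (M : ℕ) (T : Fin M → Fin M → Option (Fin 4)) : Prop :=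
  ∀ i j : Fin M, T i j = Option.map Fin.rev (T j.rev i.rev)

/-- The symmetric filling of size `M + 2` with interior `T` and leftmost column `a, c, ∅`. -/
def addColumn {M : ℕ} (a : Option (Fin 4)) (c : Fin M → Option (Fin 4))
    (T : Fin M → Fin M → Option (Fin 4)) : Fin (M + 2) → Fin (M + 2) → Option (Fin 4) :=
  withEnds (withEnds a (fun _ => none) none) (fun i => withEnds (c i) (T i) none)
    (withEnds none (fun j => Option.map Fin.rev (c j.rev)) (Option.map Fin.rev a))

lemma rev_rev_option (o : Option (Fin 4)) :
    Option.map Fin.rev (Option.map Fin.rev o) = o := by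
  cases o <;> simp

lemma map_rev_eq_some (o : Option (Fin 4)) (s : Fin 4) :
    Option.map Fin.rev o = some s ↔ o = some s.rev := by
  rcases o with _ | t
  · simp
  · simp only [Option.map_some, Option.some.injEq]
    exact Fin.rev_eq_iff

@[simp] lemma rev_four_one : Fin.rev (1 : Fin 4) = 2 := rfl

@[simp] lemma rev_four_three : Fin.rev (3 : Fin 4) = 0 := rfl

lemma eq_none_of_eq_map_rev {o : Option (Fin 4)} (h : o = Option.map Fin.rev o) : o = none := by
  revert o; decide

lemma IsMirror.antidiagonal {M : ℕ} {T : Fin M → Fin M → Option (Fin 4)} (hT : IsMirror M T)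
    {i j : Fin M} (h : i.rev = j) : T i j = none := by
  subst h
  apply eq_none_of_eq_map_rev
  conv_lhs => rw [hT]
  simp

lemma isMirror_addColumn {M : ℕ} (a : Option (Fin 4)) (c : Fin M → Option (Fin 4))
    (T : Fin M → Fin M → Option (Fin 4)) :
    IsMirror (M + 2) (addColumn a c T) ↔ IsMirror M T := by
  simp [IsMirror, forall_ends, addColumn, Fin.rev_last, Fin.rev_zero, -Option.map_map, rev_rev_option]


/-- The condition on a new leftmost column `a, c` to be compatible with the set `f` of rows
that may still be extended to the left. -/
def ColumnOK {M : ℕ} (f : Fin M → Prop) (a : Option (Fin 4)) (c : Fin M → Option (Fin 4)) :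
    Prop :=
  a ≠ none ∧ ((a = some 0 ∨ a = some 2) → ∀ i, c i = none) ∧
    (∀ i i', i < i' → (c i = some 0 ∨ c i = some 2) → c i' = none) ∧
    (∀ i, ¬ f i → c i = none)

/-- A row is free when it contains no `β` and no `δ`. -/
def FreeRow {M : ℕ} (T : Fin M → Fin M → Option (Fin 4)) (i : Fin M) : Prop :=
  ∀ j, ¬ (T i j = some 1 ∨ T i j = some 3)

lemma isStaircase_addColumn {M : ℕ} (a : Option (Fin 4)) (c : Fin M → Option (Fin 4))
    {T : Fin M → Fin M → Option (Fin 4)} (hT : IsMirror M T) :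
    IsStaircase (M + 2) (addColumn a c T) ↔ IsStaircase M T ∧ ColumnOK (FreeRow T) a c := by
  constructor
  · rintro ⟨h1, h2, h3, h4⟩
    refine ⟨⟨fun i j h => ?_, fun i => ?_, fun i j i' h h' => ?_, fun i j j' h h' => ?_⟩,
      ?_, fun h i => ?_, fun i i' h => ?_, fun i h => ?_⟩
    · simpa [addColumn] using h1 (midIdx i) (midIdx j) (by simpa)
    · simpa [addColumn] using h2 (midIdx i)
    · simpa [addColumn] using h3 (midIdx i) (midIdx j) (midIdx i') (by simpa) (by simpa)
    · simpa [addColumn] using h4 (midIdx i) (midIdx j) (midIdx j') (by simpa) (by simpa)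
    · simpa [addColumn] using h2 0
    · simpa [addColumn] using h3 0 0 (midIdx i) le_rfl (by simp) (by simpa [addColumn])
    · simpa [addColumn] using h3 (midIdx i) 0 (midIdx i') (by simp) (by simpa)
    · unfold FreeRow at h
      push Not at h
      obtain ⟨j, hj⟩ := h
      have hji : j ≤ i := by
        by_contra hlt
        have := h1 (midIdx i) (midIdx j) (by simpa using hlt)
        simp [addColumn] at this
        simp [this] at hj
      simpa [addColumn] using
        h4 (midIdx i) (midIdx j) 0 (by simp) (by simpa) (by simpa [addColumn] using hj)
  · rintro ⟨⟨h1, h2, h3, h4⟩, g1, g2, g3, g4⟩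
    have g5 : ∀ i j, (T i j = some 1 ∨ T i j = some 3) → c i = none := fun i j h =>
      g4 i fun hf => hf j h
    have g6 : ∀ i j, (T i j = some 0 ∨ T i j = some 2) → c j.rev = none := fun i j h => by
      apply g5 j.rev i.rev
      rw [hT] at h
      simp only [map_rev_eq_some] at h
      exact h.symm
    refine ⟨?_, ?_, ?_, ?_⟩ <;> simp only [forall_ends] <;>
      simp [addColumn, map_rev_eq_some, -Option.map_eq_some_iff, -not_le, -not_lt]
    · exact h1
    · exact ⟨g1, h2, g1⟩
    · exact ⟨fun i h => g2 h i, fun i => ⟨g3 i, fun j => ⟨fun i' => h3 i j i', fun _ => g6 i j⟩⟩⟩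
    · refine ⟨fun i j => ⟨fun _ => g5 i j, fun j' => h4 i j j'⟩, fun i j hj _ h => ?_,
        fun i h => g2 h.symm _⟩
      exact g3 i.rev j.rev (by simpa) h.symm

section ColumnSum

variable {R : Type*} [CommRing R] (v : Fin 4 → R) (z x : R)

/-- The value of a label, empty cells counting as `1`. -/
def labelValue : Option (Fin 4) → R
  | none => 1
  | some s => v s

open Classical in
/-- The weight of a new leftmost column, `x` marking the rows that stay free. -/
def columnWeight {M : ℕ} (f : Fin M → Prop) (a : Option (Fin 4)) (c : Fin M → Option (Fin 4)) :
    R :=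
  if ColumnOK f a c then
    labelValue v a * (∏ i, labelValue v (c i)) *
      (if ((a = some 0 ∨ a = some 1) ∧ ∀ i, c i = none) ∨
        (∃ i, (c i = some 0 ∨ c i = some 1) ∧ ∀ i', i < i' → c i' = none) then z else 1) *
      ((if ¬ (a = some 1 ∨ a = some 3) then x else 1) *
        ((∏ i, if ¬ (c i = some 1 ∨ c i = some 3) ∧ f i then x else 1) *
          (if ¬ (a = some 0 ∨ a = some 2) ∧ ∀ i, ¬ (c i = some 0 ∨ c i = some 2)
            then x else 1)))
  else 0

open Classical in
/-- The contribution of a cell lying below a non-empty cell of its column. -/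
def coveredWeight (p : Prop) : Option (Fin 4) → R
  | none => if p then x else 1
  | some s => if p ∧ (s = 1 ∨ s = 3) then v s else 0

open Classical in
lemma sum_coveredWeight {M : ℕ} (f : Fin M → Prop) :
    ∑ c : Fin M → Option (Fin 4), ∏ i, coveredWeight v x (f i) (c i) =
      ∏ i, if f i then x + (v 1 + v 3) else 1 := by
  rw [← Fintype.prod_sum (fun i o => coveredWeight v x (f i) o)]
  refine Finset.prod_congr rfl fun i _ => ?_
  rw [Fintype.sum_option, Fin.sum_univ_four]
  by_cases h : f i <;> simp [coveredWeight, h]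

/-- The contribution of a bottom cell lying below a non-empty cell of its column. -/
def coveredBase : Option (Fin 4) → R
  | some 1 => v 1
  | some 3 => v 3
  | _ => 0

open Classical in
lemma coveredBase_mul_prod {M : ℕ} (f : Fin M → Prop) (a : Option (Fin 4))
    (c : Fin M → Option (Fin 4)) :
    coveredBase v a * ∏ i, coveredWeight v x (f i) (c i) =
      if ((a = some 1 ∨ a = some 3) ∧ (∀ i, ¬ (c i = some 0 ∨ c i = some 2)) ∧
        ∀ i, ¬ f i → c i = none) then
        labelValue v a * (∏ i, labelValue v (c i)) *
          ∏ i, if ¬ (c i = some 1 ∨ c i = some 3) ∧ f i then x else 1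
      else 0 := by
  have hp : ∀ i, coveredWeight v x (f i) (c i) =
      if ¬ (c i = some 0 ∨ c i = some 2) ∧ (¬ f i → c i = none) then
        labelValue v (c i) * (if ¬ (c i = some 1 ∨ c i = some 3) ∧ f i then x else 1) else 0 := by
    intro i
    generalize c i = o
    by_cases h : f i
    · rcases o with _ | s
      · simp [coveredWeight, labelValue, h]
      · fin_cases s <;> simp [coveredWeight, labelValue, h]
    · rcases o with _ | s
      · simp [coveredWeight, labelValue, h]
      · simp [coveredWeight, h]
  simp only [hp, Finset.prod_ite_zero, Finset.prod_mul_distrib]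
  rcases a with _ | s
  · simp [coveredBase]
  · fin_cases s <;> simp [coveredBase, labelValue, forall_and, mul_assoc]

lemma columnOK_snoc_some {M : ℕ} (f : Fin (M + 1) → Prop) (a : Option (Fin 4))
    (c : Fin M → Option (Fin 4)) (s : Fin 4) :
    ColumnOK f a (Fin.snoc c (some s) : Fin (M + 1) → Option (Fin 4)) ↔
      f (Fin.last M) ∧ (a = some 1 ∨ a = some 3) ∧ (∀ i, ¬ (c i = some 0 ∨ c i = some 2)) ∧
        ∀ i : Fin M, ¬ f i.castSucc → c i = none := by
  have ha : (a ≠ none ∧ ¬ (a = some 0 ∨ a = some 2)) ↔ (a = some 1 ∨ a = some 3) := by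
    revert a; decide
  have hl : ∀ i : Fin M, ¬ Fin.last M < i.castSucc := fun i => not_lt.2 (Fin.le_last _)
  rw [← ha]
  simp only [ColumnOK, Fin.forall_fin_succ', Fin.snoc_castSucc, Fin.snoc_last, hl,
    Fin.castSucc_lt_last, Fin.castSucc_lt_castSucc_iff, lt_irrefl, reduceCtorEq]
  constructor
  · rintro ⟨h1, h2, ⟨h3, -⟩, h4, h5⟩
    exact ⟨by tauto, by tauto, fun i h => (h3 i).2 trivial h, h4⟩
  · rintro ⟨h1, h2, h3, h4⟩
    exact ⟨h2.1, fun h => (h2.2 h).elim, ⟨fun i => ⟨fun i' _ h => (h3 i h).elim,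
      fun _ h => h3 i h⟩, fun i h => h.elim, fun h => h.elim⟩, h4, fun h => (h h1).elim⟩

open Classical in
lemma columnWeight_snoc_none {M : ℕ} (f : Fin (M + 1) → Prop) (a : Option (Fin 4))
    (c : Fin M → Option (Fin 4)) :
    columnWeight v z x f a (Fin.snoc c none : Fin (M + 1) → Option (Fin 4)) =
      (if f (Fin.last M) then x else 1) * columnWeight v z x (fun i => f i.castSucc) a c := by
  simp only [columnWeight, ColumnOK, Fin.forall_fin_succ', Fin.exists_fin_succ',
    Fin.prod_univ_castSucc, Fin.snoc_castSucc, Fin.snoc_last, Fin.castSucc_lt_castSucc_iff,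
    reduceCtorEq, or_self, false_and, or_false, not_false_eq_true, implies_true, and_true,
    true_and, false_implies, labelValue]
  generalize (if f (Fin.last M) then x else 1) = y
  split_ifs <;> ring

open Classical in
lemma columnWeight_snoc_some {M : ℕ} (f : Fin (M + 1) → Prop) (a : Option (Fin 4))
    (c : Fin M → Option (Fin 4)) (s : Fin 4) :
    columnWeight v z x f a (Fin.snoc c (some s) : Fin (M + 1) → Option (Fin 4)) =
      (if f (Fin.last M) then x * v s * (if s = 0 ∨ s = 1 then z else 1) else 0) *
        (coveredBase v a * ∏ i, coveredWeight v x (f i.castSucc) (c i)) := by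
  rw [coveredBase_mul_prod, columnWeight]
  simp only [columnOK_snoc_some]
  by_cases hf : f (Fin.last M)
  swap
  · simp [hf]
  by_cases h : (a = some 1 ∨ a = some 3) ∧ (∀ i, ¬ (c i = some 0 ∨ c i = some 2)) ∧
        ∀ i : Fin M, ¬ f i.castSucc → c i = none
  swap
  · rw [if_neg (fun h' => h h'.2), if_neg h, mul_zero]
  rw [if_pos ⟨hf, h⟩, if_pos h, if_pos hf]
  have hl : ∀ i : Fin M, ¬ Fin.last M < i.castSucc := fun i => not_lt.2 (Fin.le_last _)
  have ha : ¬ (a = some 0 ∨ a = some 2) := by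
    rcases h.1 with rfl | rfl <;> decide
  simp only [Fin.forall_fin_succ', Fin.exists_fin_succ', Fin.prod_univ_castSucc,
    Fin.snoc_castSucc, Fin.snoc_last, hl, h.1, h.2.1, ha, hf, Fin.castSucc_lt_last, lt_irrefl]
  have hv : labelValue v (some s) = v s := rfl
  rw [hv]
  fin_cases s <;> simp <;> ring

open Classical in
lemma sum_columnWeight {M : ℕ} (f : Fin M → Prop) :
    ∑ a : Option (Fin 4), ∑ c : Fin M → Option (Fin 4), columnWeight v z x f a c =
      (z * (v 0 + v 1) + v 2 + v 3) * x * ∏ i, if f i then x + (v 1 + v 3) else 1 := by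
  induction M with
  | zero =>
    simp [Fintype.sum_option, Fin.sum_univ_four, columnWeight, ColumnOK, labelValue]
    ring
  | succ M ih =>
    have hsum : ∀ a : Option (Fin 4),
        ∑ c : Fin (M + 1) → Option (Fin 4), columnWeight v z x f a c =
          (if f (Fin.last M) then x else 1) *
            ∑ c : Fin M → Option (Fin 4), columnWeight v z x (fun i => f i.castSucc) a c +
          (if f (Fin.last M) then x * (z * (v 0 + v 1) + v 2 + v 3) else 0) *
            (coveredBase v a * ∏ i : Fin M,
              if f i.castSucc then x + (v 1 + v 3) else 1) := by
      intro a
      rw [← (Fin.snocEquiv fun _ => Option (Fin 4)).sum_comp, Fintype.sum_prod_type,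
        Fintype.sum_option, Fin.sum_univ_four]
      have hs : ∀ (o : Option (Fin 4)) (c : Fin M → Option (Fin 4)),
        (Fin.snocEquiv fun _ => Option (Fin 4)) (o, c) =
          (Fin.snoc c o : Fin (M + 1) → Option (Fin 4)) := fun _ _ => rfl
      simp only [hs, columnWeight_snoc_none, columnWeight_snoc_some, ← Finset.mul_sum, sum_coveredWeight]
      by_cases h : f (Fin.last M)
      · simp [h]; ring
      · simp [h]
    simp only [hsum, Finset.sum_add_distrib, ← Finset.mul_sum, ih, ← Finset.sum_mul]
    have hb : ∑ a, coveredBase v a = v 1 + v 3 := by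
      simp [Fintype.sum_option, Fin.sum_univ_four, coveredBase]
    rw [hb, Fin.prod_univ_castSucc]
    by_cases h : f (Fin.last M)
    · simp [h]; ring
    · simp [h]

lemma nearestBelow_eq {n : ℕ} {T : Fin n → Fin n → Option (Fin 4)} {i j m : Fin n}
    (hmi : m < i) (hm : T m j ≠ none) (h : ∀ k, m < k → k < i → T k j = none) :
    nearestBelow n T i j = T m j := by
  have hne : (univ.filter fun i' : Fin n => i' < i ∧ T i' j ≠ none).Nonempty :=
    ⟨m, by simp [hmi, hm]⟩
  have hmax : (univ.filter fun i' : Fin n => i' < i ∧ T i' j ≠ none).max' hne = m := by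
    apply le_antisymm
    · refine Finset.max'_le _ _ _ fun k hk => ?_
      simp only [mem_filter, mem_univ, true_and] at hk
      by_contra hlt
      exact hk.2 (h k (not_le.1 hlt) hk.1)
    · exact Finset.le_max' _ _ (by simp [hmi, hm])
  rw [nearestBelow, dif_pos hne, hmax]

lemma nearestRight_eq {n : ℕ} {T : Fin n → Fin n → Option (Fin 4)} {i j m : Fin n}
    (hmj : j < m) (hm : T i m ≠ none) (h : ∀ k, j < k → k < m → T i k = none) :
    nearestRight n T i j = T i m := by
  have hne : (univ.filter fun j' : Fin n => j < j' ∧ T i j' ≠ none).Nonempty :=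
    ⟨m, by simp [hmj, hm]⟩
  have hmin : (univ.filter fun j' : Fin n => j < j' ∧ T i j' ≠ none).min' hne = m := by
    apply le_antisymm
    · exact Finset.min'_le _ _ (by simp [hmj, hm])
    · refine Finset.le_min' _ _ _ fun k hk => ?_
      simp only [mem_filter, mem_univ, true_and] at hk
      by_contra hlt
      exact hk.2 (h k hk.1 (not_le.1 hlt))
  rw [nearestRight, dif_pos hne, hmin]

/-- On the symmetry diagonal, a cell receives a `q` exactly when the nearest non-empty cell
below it contains an `α` or a `β`. -/
lemma qCell_antidiagonal {M : ℕ} {T : Fin M → Fin M → Option (Fin 4)} (hS : IsStaircase M T)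
    (hT : IsMirror M T) {i j : Fin M} (hij : i.rev = j) (hle : j ≤ i) :
    QCell M T i j ↔ ∃ k, k < i ∧ (T k j = some 0 ∨ T k j = some 1) ∧
      ∀ l, k < l → l < i → T l j = none := by
  have hlt : j < i := lt_of_le_of_ne hle fun h => hS.2.1 i (by
    have := hT.antidiagonal hij
    rwa [h] at this)
  have hne : (univ.filter fun k : Fin M => k < i ∧ T k j ≠ none).Nonempty :=
    ⟨j, by simpa [hlt] using hS.2.1 j⟩
  obtain ⟨m, hm, hmax⟩ := Finset.exists_max_image _ id hne
  simp only [mem_filter, mem_univ, true_and, id] at hm hmax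
  have hgap : ∀ k, m < k → k < i → T k j = none := fun k h1 h2 => by
    by_contra h3
    exact absurd (hmax k ⟨h2, h3⟩) (not_le.2 h1)
  have hrow : ∀ k, T i k = Option.map Fin.rev (T k.rev j) := fun k => by rw [hT, hij]
  have hbelow := nearestBelow_eq hm.1 hm.2 hgap
  have hright : nearestRight M T i j = Option.map Fin.rev (T m j) := by
    rw [nearestRight_eq (m := m.rev) _ _ _, hrow, Fin.rev_rev]
    · rw [← hij]
      exact Fin.rev_lt_rev.2 hm.1
    · rw [hrow, Fin.rev_rev]
      simpa using hm.2
    · intro k h1 h2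
      rw [hrow, hgap k.rev (Fin.lt_rev_iff.1 h2) (by
        rw [← hij] at h1; exact Fin.rev_lt_iff.1 h1)]
      rfl
  have hcell : QCell M T i j ↔ (T m j = some 0 ∨ T m j = some 1) := by
    rw [QCell, hright, hbelow]
    generalize T m j = o
    revert o; decide
  rw [hcell]
  constructor
  · exact fun h => ⟨m, hm.1, h, hgap⟩
  · rintro ⟨k, hk, h, hk'⟩
    have hkm : k = m := by
      rcases lt_trichotomy k m with h1 | h1 | h1
      · exact absurd (hk' m h1 hm.1) hm.2
      · exact h1
      · rw [hgap k h1 hk] at h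
        simp at h
    rwa [← hkm]

/-- The contribution of a cell to the weight of a symmetric tableau at `q = u = 1`. -/
def cellFactor {M : ℕ} (T : Fin M → Fin M → Option (Fin 4)) (i j : Fin M) : R :=
  (if j ≤ i ∧ i.val + j.val + 1 = M ∧ T i j = none ∧ QCell M T i j then z else 1) *
    (if j ≤ i ∧ i.val + j.val < M then labelValue v (T i j) else 1)

/-- The weight of a symmetric tableau at `q = u = 1`, as a product over all cells. -/
def tableauWeight {M : ℕ} (T : Fin M → Fin M → Option (Fin 4)) : R :=
  ∏ i : Fin M, ∏ j : Fin M, cellFactor v z T i j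

lemma cellFactor_of_lt {M : ℕ} (T : Fin M → Fin M → Option (Fin 4)) {i j : Fin M} (h : i < j) :
    cellFactor v z T i j = 1 := by
  simp [cellFactor, not_le.2 h]

lemma cellFactor_of_above {M : ℕ} (T : Fin M → Fin M → Option (Fin 4)) {i j : Fin M}
    (h : M ≤ i.val + j.val) : cellFactor v z T i j = 1 := by
  rw [cellFactor, if_neg (by omega), if_neg (by omega), mul_one]

lemma cellFactor_of_below {M : ℕ} (T : Fin M → Fin M → Option (Fin 4)) {i j : Fin M}
    (h : i.val + j.val + 1 < M) (hle : j ≤ i) :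
    cellFactor v z T i j = labelValue v (T i j) := by
  rw [cellFactor, if_neg (by omega), if_pos ⟨hle, by omega⟩, one_mul]

lemma rev_eq_of_add {M : ℕ} {i j : Fin M} (h : i.val + j.val + 1 = M) : i.rev = j := by
  ext; simp [Fin.val_rev]; omega

lemma qCell_addColumn {M : ℕ} {a : Option (Fin 4)} {c : Fin M → Option (Fin 4)}
    {T : Fin M → Fin M → Option (Fin 4)} (hT : IsMirror M T) (hS : IsStaircase M T)
    (hc : ColumnOK (FreeRow T) a c) {i j : Fin M} (hij : i.val + j.val + 1 = M) (hle : j ≤ i) :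
    QCell (M + 2) (addColumn a c T) (midIdx i) (midIdx j) ↔ QCell M T i j := by
  have hr := rev_eq_of_add hij
  rw [qCell_antidiagonal hS hT hr hle,
    qCell_antidiagonal ((isStaircase_addColumn a c hT).2 ⟨hS, hc⟩)
      ((isMirror_addColumn a c T).2 hT) (by rw [midIdx_rev, hr]) (by simpa)]
  simp [exists_ends, forall_ends, addColumn]

lemma qCell_addColumn_corner {M : ℕ} {a : Option (Fin 4)} {c : Fin M → Option (Fin 4)}
    {T : Fin M → Fin M → Option (Fin 4)} (hT : IsMirror M T) (hS : IsStaircase M T)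
    (hc : ColumnOK (FreeRow T) a c) :
    QCell (M + 2) (addColumn a c T) (Fin.last (M + 1)) 0 ↔
      ((a = some 0 ∨ a = some 1) ∧ ∀ i, c i = none) ∨
        (∃ i, (c i = some 0 ∨ c i = some 1) ∧ ∀ i', i < i' → c i' = none) := by
  rw [qCell_antidiagonal ((isStaircase_addColumn a c hT).2 ⟨hS, hc⟩)
      ((isMirror_addColumn a c T).2 hT) (by simp) (by simp)]
  simp [exists_ends, forall_ends, addColumn, Fin.last_pos]

open Classical in
lemma tableauWeight_addColumn {M : ℕ} {a : Option (Fin 4)} {c : Fin M → Option (Fin 4)}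
    {T : Fin M → Fin M → Option (Fin 4)} (hT : IsMirror M T) (hS : IsStaircase M T)
    (hc : ColumnOK (FreeRow T) a c) :
    tableauWeight v z (addColumn a c T) =
      labelValue v a * (∏ i, labelValue v (c i)) *
        (if ((a = some 0 ∨ a = some 1) ∧ ∀ i, c i = none) ∨
          (∃ i, (c i = some 0 ∨ c i = some 1) ∧ ∀ i', i < i' → c i' = none) then z else 1) *
        tableauWeight v z T := by
  have hmid : ∀ i j : Fin M,
      cellFactor v z (addColumn a c T) (midIdx i) (midIdx j) = cellFactor v z T i j := by
    intro i j
    have he : addColumn a c T (midIdx i) (midIdx j) = T i j := by simp [addColumn]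
    have hs : (midIdx i).val + (midIdx j).val + 1 = M + 2 ↔ i.val + j.val + 1 = M := by
      simp only [midIdx_val]; omega
    have hs' : (midIdx i).val + (midIdx j).val < M + 2 ↔ i.val + j.val < M := by
      simp only [midIdx_val]; omega
    simp only [cellFactor, midIdx_le_midIdx, he, hs, hs']
    congr 1
    refine if_congr ?_ rfl rfl
    exact ⟨fun ⟨h1, h2, h3, h4⟩ => ⟨h1, h2, h3, (qCell_addColumn hT hS hc h2 h1).1 h4⟩,
      fun ⟨h1, h2, h3, h4⟩ => ⟨h1, h2, h3, (qCell_addColumn hT hS hc h2 h1).2 h4⟩⟩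
  have h00 : cellFactor v z (addColumn a c T) 0 0 = labelValue v a := by
    rw [cellFactor_of_below v z _ (by simp) le_rfl]
    simp [addColumn]
  have hm0 : ∀ i, cellFactor v z (addColumn a c T) (midIdx i) 0 = labelValue v (c i) := by
    intro i
    rw [cellFactor_of_below v z _ (by simp) (Fin.zero_le _)]
    simp [addColumn]
  have hl0 : cellFactor v z (addColumn a c T) (Fin.last (M + 1)) 0 =
      if ((a = some 0 ∨ a = some 1) ∧ ∀ i, c i = none) ∨
        (∃ i, (c i = some 0 ∨ c i = some 1) ∧ ∀ i', i < i' → c i' = none) then z else 1 := by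
    have he : addColumn a c T (Fin.last (M + 1)) 0 = none := by simp [addColumn]
    simp only [cellFactor, he, qCell_addColumn_corner hT hS hc]
    simp [labelValue]
  have h0m : ∀ j, cellFactor v z (addColumn a c T) 0 (midIdx j) = 1 := fun j =>
    cellFactor_of_lt v z _ (by simp)
  have h0l : cellFactor v z (addColumn a c T) 0 (Fin.last (M + 1)) = 1 :=
    cellFactor_of_lt v z _ Fin.last_pos
  have hml : ∀ i, cellFactor v z (addColumn a c T) (midIdx i) (Fin.last (M + 1)) = 1 := fun i =>
    cellFactor_of_lt v z _ (by simp)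
  have hlm : ∀ j, cellFactor v z (addColumn a c T) (Fin.last (M + 1)) (midIdx j) = 1 := fun j =>
    cellFactor_of_above v z _ (by simp; omega)
  have hll : cellFactor v z (addColumn a c T) (Fin.last (M + 1)) (Fin.last (M + 1)) = 1 :=
    cellFactor_of_above v z _ (by simp; omega)
  simp only [tableauWeight, prod_ends, hmid, h00, hm0, hl0, h0m, h0l, hml, hlm, hll,
    Finset.prod_const_one, mul_one, Finset.prod_mul_distrib]
  ring

open Classical in
/-- The symmetric tableaux of size `M`. -/
def symmetricTableaux (M : ℕ) : Finset (Fin M → Fin M → Option (Fin 4)) :=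
  univ.filter fun T => IsStaircase M T ∧ IsMirror M T

open Classical in
/-- The generating function of symmetric tableaux, `x` marking free rows. -/
def freeRowSum (M : ℕ) : R :=
  ∑ T ∈ symmetricTableaux M, tableauWeight v z T * ∏ i, if FreeRow T i then x else 1

lemma exists_eq_addColumn {M : ℕ} {T : Fin (M + 2) → Fin (M + 2) → Option (Fin 4)}
    (hS : IsStaircase (M + 2) T) (hT : IsMirror (M + 2) T) :
    addColumn (T 0 0) (fun i => T (midIdx i) 0) (fun i j => T (midIdx i) (midIdx j)) = T := by
  have hcorner : T (Fin.last (M + 1)) 0 = none := hT.antidiagonal (by simp)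
  have hup := hS.1
  simp only [funext_iff, forall_ends]
  refine ⟨⟨?_, fun j => ?_, ?_⟩, fun i => ⟨?_, fun j => ?_, ?_⟩, ?_, fun j => ?_, ?_⟩
  · simp [addColumn]
  · simp [addColumn, hup 0 (midIdx j)]
  · simp [addColumn, hup 0 (Fin.last (M + 1)) Fin.last_pos]
  · simp [addColumn]
  · simp [addColumn]
  · simp [addColumn, hup (midIdx i) (Fin.last (M + 1))]
  · simp [addColumn, hcorner]
  · rw [hT (Fin.last (M + 1)) (midIdx j)]
    simp [addColumn]
  · rw [hT (Fin.last (M + 1)) (Fin.last (M + 1))]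
    simp [addColumn]

open Classical in
lemma tableauWeight_addColumn_mul {M : ℕ} {a : Option (Fin 4)} {c : Fin M → Option (Fin 4)}
    {T : Fin M → Fin M → Option (Fin 4)} (hT : IsMirror M T) (hS : IsStaircase M T)
    (hc : ColumnOK (FreeRow T) a c) :
    tableauWeight v z (addColumn a c T) *
        ∏ i, (if FreeRow (addColumn a c T) i then x else 1) =
      tableauWeight v z T * columnWeight v z x (FreeRow T) a c := by
  have h0 : FreeRow (addColumn a c T) 0 ↔ ¬ (a = some 1 ∨ a = some 3) := by
    simp [FreeRow, forall_ends, addColumn]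
  have hm : ∀ i, FreeRow (addColumn a c T) (midIdx i) ↔
      ¬ (c i = some 1 ∨ c i = some 3) ∧ FreeRow T i := by
    simp [FreeRow, forall_ends, addColumn]
  have hl : FreeRow (addColumn a c T) (Fin.last (M + 1)) ↔
      ¬ (a = some 0 ∨ a = some 2) ∧ ∀ i, ¬ (c i = some 0 ∨ c i = some 2) := by
    have hr : (∀ i : Fin M, ¬ (c i.rev = some 2 ∨ c i.rev = some 0)) ↔
        ∀ i, ¬ (c i = some 0 ∨ c i = some 2) :=
      ⟨fun h i => by simpa [or_comm] using h i.rev, fun h i => by simpa [or_comm] using h i.rev⟩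
    rw [← hr, or_comm]
    simp only [FreeRow, forall_ends, addColumn, withEnds_last, withEnds_zero, withEnds_midIdx,
      map_rev_eq_some, rev_four_one, rev_four_three]
    simp [and_comm]
  rw [columnWeight, if_pos hc, tableauWeight_addColumn v z hT hS hc, prod_ends]
  simp only [h0, hm, hl]
  ring

lemma freeRowSum_add_two (M : ℕ) :
    freeRowSum v z x (M + 2) =
      (z * (v 0 + v 1) + v 2 + v 3) * x * freeRowSum v z (x + (v 1 + v 3)) M := by
  classical
  have hcol : ∀ T : Fin M → Fin M → Option (Fin 4),
      ∑ p : Option (Fin 4) × (Fin M → Option (Fin 4)), columnWeight v z x (FreeRow T) p.1 p.2 =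
        ∑ p ∈ univ.filter fun p : Option (Fin 4) × (Fin M → Option (Fin 4)) =>
          ColumnOK (FreeRow T) p.1 p.2, columnWeight v z x (FreeRow T) p.1 p.2 := fun T => by
    symm
    apply Finset.sum_filter_of_ne
    intro p _ h
    by_contra h'
    exact h (if_neg h')
  calc freeRowSum v z x (M + 2)
      = ∑ q ∈ (symmetricTableaux M).sigma fun T =>
          univ.filter fun p : Option (Fin 4) × (Fin M → Option (Fin 4)) =>
            ColumnOK (FreeRow T) p.1 p.2,
          tableauWeight v z q.1 * columnWeight v z x (FreeRow q.1) q.2.1 q.2.2 := by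
        symm
        refine Finset.sum_bij' (fun q _ => addColumn q.2.1 q.2.2 q.1)
          (fun T _ => ⟨fun i j => T (midIdx i) (midIdx j), T 0 0, fun i => T (midIdx i) 0⟩)
          ?_ ?_ ?_ ?_ ?_
        · rintro ⟨T, a, c⟩ h
          simp only [symmetricTableaux, mem_sigma, mem_filter, mem_univ, true_and] at h ⊢
          exact ⟨(isStaircase_addColumn a c h.1.2).2 ⟨h.1.1, h.2⟩,
            (isMirror_addColumn a c T).2 h.1.2⟩
        · intro T h
          simp only [symmetricTableaux, mem_sigma, mem_filter, mem_univ, true_and] at h ⊢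
          have he := exists_eq_addColumn h.1 h.2
          have hT := h.2
          rw [← he, isMirror_addColumn] at hT
          have hS := h.1
          rw [← he, isStaircase_addColumn _ _ hT] at hS
          exact ⟨⟨hS.1, hT⟩, hS.2⟩
        · rintro ⟨T, a, c⟩ h
          simp [addColumn]
        · intro T h
          simp only [symmetricTableaux, mem_filter, mem_univ, true_and] at h
          exact exists_eq_addColumn h.1 h.2
        · rintro ⟨T, a, c⟩ h
          simp only [symmetricTableaux, mem_sigma, mem_filter, mem_univ, true_and] at h
          exact (tableauWeight_addColumn_mul v z x h.1.2 h.1.1 h.2).symm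
    _ = _ := by
        rw [Finset.sum_sigma, freeRowSum, Finset.mul_sum]
        refine Finset.sum_congr rfl fun T _ => ?_
        simp only
        rw [← Finset.mul_sum, ← hcol, Fintype.sum_prod_type, sum_columnWeight]
        ring

lemma freeRowSum_two_mul (n : ℕ) :
    freeRowSum v z x (2 * n) =
      (z * (v 0 + v 1) + v 2 + v 3) ^ n * ∏ i ∈ range n, (x + (i : R) * (v 1 + v 3)) := by
  induction n generalizing x with
  | zero =>
    have h : symmetricTableaux (2 * 0) = univ := by
      ext T
      simp [symmetricTableaux, IsStaircase, IsMirror]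
    simp [freeRowSum, h, tableauWeight]
  | succ n ih =>
    rw [mul_add, mul_one, freeRowSum_add_two, ih, Finset.prod_range_succ']
    have hp : ∀ i : ℕ, x + (v 1 + v 3) + (i : R) * (v 1 + v 3) =
        x + ((i + 1 : ℕ) : R) * (v 1 + v 3) := fun i => by push_cast; ring
    simp only [hp]
    push_cast
    ring

end ColumnSum

lemma subQU7_wtB {n : ℕ} (T : TypeBTableau n) :
    subQU7 (wtB T) =
      tableauWeight (fun s : Fin 4 => (X (Fin.castLE (by omega) s) : P7)) (X 6) T.1.1 := by
  have hcell : ∀ i j, subQU7 (cellValue7 (2 * n) T.1.1 i j) =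
      labelValue (fun s : Fin 4 => (X (Fin.castLE (by omega) s) : P7)) (T.1.1 i j) := by
    intro i j
    unfold cellValue7
    rcases T.1.1 i j with _ | s
    · simp only [labelValue]
      split_ifs <;> simp [subQU7]
    · simp only [labelValue, subQU7, aeval_X, Fin.val_castLE]
      rw [if_neg (by omega)]
  have hz : subQU7 (X 6) = X 6 := by simp [subQU7]
  rw [wtB, map_mul, map_pow, hz, ← Finset.prod_const, Finset.prod_filter,
    Fintype.prod_prod_type, tableauWeight]
  simp only [cellFactor, map_prod, apply_ite subQU7, map_one, hcell, ← Finset.prod_mul_distrib]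

lemma subQU7_ZB (n : ℕ) :
    subQU7 (ZB n) =
      freeRowSum (fun s : Fin 4 => (X (Fin.castLE (by omega) s) : P7)) (X 6) 1 (2 * n) := by
  classical
  rw [ZB, map_sum, freeRowSum]
  refine Finset.sum_bij (fun T _ => T.1.1) ?_ ?_ ?_ ?_
  · intro T _
    simp only [symmetricTableaux, mem_filter, mem_univ, true_and]
    exact ⟨T.1.2, T.2⟩
  · intro T _ T' _ h
    exact Subtype.ext (Subtype.ext h)
  · intro T h
    simp only [symmetricTableaux, mem_filter, mem_univ, true_and] at h
    exact ⟨⟨⟨T, h.1⟩, h.2⟩, mem_univ _, rfl⟩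
  · intro T _
    simp [subQU7_wtB]

/-- substituting `q = u = 1` in `Z^B_n(α,β,γ,δ;q,u,z)` yields
`(z(α+β)+γ+δ)^n ∏_{i=1}^{n−1} (1 + i(β+δ))`. -/
theorem statement17 (n : ℕ) :
    subQU7 (ZB n) =
      (X 6 * (X 0 + X 1) + X 2 + X 3) ^ n *
        ∏ i ∈ Finset.Icc 1 (n - 1), (1 + (i : P7) * (X 1 + X 3)) := by
  rw [subQU7_ZB, freeRowSum_two_mul]
  have hv : ∀ k : Fin 4, (X (Fin.castLE (by omega) k) : P7) = X ⟨k.val, by omega⟩ := fun _ => rfl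
  have hprod : ∏ i ∈ range n, ((1 : P7) + (i : P7) * (X 1 + X 3)) =
      ∏ i ∈ Finset.Icc 1 (n - 1), (1 + (i : P7) * (X 1 + X 3)) := by
    rcases n with _ | n
    · simp
    · rw [Finset.prod_range_succ', Nat.add_sub_cancel, Finset.range_eq_Ico,
        Finset.prod_Ico_add' (fun i : ℕ => (1 : P7) + (i : P7) * (X 1 + X 3)) 0 n 1]
      simp [Finset.Ico_add_one_right_eq_Icc]
  rw [← hprod]
  rfl
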